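/- arXiv:hep-th/0703111 — 8 statements merged into one kernel-verified Lean document; each statement's English description precedes it below -/
import Mathlib

section
/- Let g be a positive definite symmetric bilinear form on V, identified with the isomorphism g : V → V*, x ↦ g(x,·), with inverse g⁻¹ : V* → V, let B be an alternating bilinear form on V with induced map B : V → V*, and define G := e^B ∘ M_G ∘ e^{−B} : W → W, where M_G(X,η) := (g⁻¹η, g X). Then G² = id, G preserves the natural pairing (⟨G u, G v⟩ = ⟨u, v⟩ for all u, v), and G defines a positive definite metric on W: ⟨G w, w⟩ > 0 for every nonzero w ∈ W. -/
open Module LinearMap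

variable (V : Type*) [AddCommGroup V] [Module ℝ V] [FiniteDimensional ℝ V]

/-- The natural pairing on `W = V × V*`:
`⟨(X,η),(Y,λ)⟩ := (1/2)(λ(X) + η(Y))`. -/
noncomputable def naturalPairing :
    LinearMap.BilinForm ℝ (V × Module.Dual ℝ V) :=
  LinearMap.mk₂ ℝ (fun u v => (1 / 2 : ℝ) * (v.2 u.1 + u.2 v.1))
    (fun m₁ m₂ n => by simp; ring)
    (fun c m n => by simp; ring)
    (fun m n₁ n₂ => by simp; ring)
    (fun m c n => by simp; ring)

/-- The `b`-transform `e^b : W → W`, `e^b(X,η) := (X, η + b(X,·))`. -/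
noncomputable def bTransform (b : LinearMap.BilinForm ℝ V) :
    (V × Module.Dual ℝ V) →ₗ[ℝ] V × Module.Dual ℝ V :=
  (LinearMap.fst ℝ V (Module.Dual ℝ V)).prod
    (LinearMap.snd ℝ V (Module.Dual ℝ V) + b ∘ₗ LinearMap.fst ℝ V (Module.Dual ℝ V))

/-- The map `M_G(X,η) := (g⁻¹ η, g X)` on `W = V × V*`. -/
noncomputable def MG (g : LinearMap.BilinForm ℝ V) (ginv : Module.Dual ℝ V →ₗ[ℝ] V) :
    (V × Module.Dual ℝ V) →ₗ[ℝ] V × Module.Dual ℝ V :=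
  (ginv ∘ₗ LinearMap.snd ℝ V (Module.Dual ℝ V)).prod
    ((g : V →ₗ[ℝ] Module.Dual ℝ V) ∘ₗ LinearMap.fst ℝ V (Module.Dual ℝ V))

section

variable {E : Type*} [AddCommGroup E] [Module ℝ E]

@[simp]
theorem naturalPairing_apply (u v : E × Module.Dual ℝ E) :
    naturalPairing E u v = (1 / 2 : ℝ) * (v.2 u.1 + u.2 v.1) := rfl

@[simp]
theorem bTransform_apply (b : LinearMap.BilinForm ℝ E) (w : E × Module.Dual ℝ E) :
    bTransform E b w = (w.1, w.2 + b w.1) := rfl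

@[simp]
theorem MG_apply (g : LinearMap.BilinForm ℝ E) (ginv : Module.Dual ℝ E →ₗ[ℝ] E)
    (w : E × Module.Dual ℝ E) : MG E g ginv w = (ginv w.2, g w.1) := rfl

theorem bTransform_bTransform_neg (b : LinearMap.BilinForm ℝ E) (w : E × Module.Dual ℝ E) :
    bTransform E b (bTransform E (-b) w) = w := by
  simp

theorem bTransform_neg_bTransform (b : LinearMap.BilinForm ℝ E) (w : E × Module.Dual ℝ E) :
    bTransform E (-b) (bTransform E b w) = w := by
  simp

theorem naturalPairing_bTransform {b : LinearMap.BilinForm ℝ E} (hb : b.IsAlt)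
    (u v : E × Module.Dual ℝ E) :
    naturalPairing E (bTransform E b u) (bTransform E b v) = naturalPairing E u v := by
  have h : b v.1 u.1 = -b u.1 v.1 := (hb.neg_eq u.1 v.1).symm
  simp only [naturalPairing_apply, bTransform_apply, LinearMap.add_apply, h]
  ring

/-- The `b`-transforms `e^b` and `e^{-b}` are adjoint for the natural pairing. -/
theorem naturalPairing_bTransform_left {b : LinearMap.BilinForm ℝ E} (hb : b.IsAlt)
    (u v : E × Module.Dual ℝ E) :
    naturalPairing E (bTransform E b u) v = naturalPairing E u (bTransform E (-b) v) := by
  rw [← naturalPairing_bTransform hb u, bTransform_bTransform_neg]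

section MG

variable {g : LinearMap.BilinForm ℝ E} {ginv : Module.Dual ℝ E →ₗ[ℝ] E}

theorem MG_MG (h₁ : ∀ η, g (ginv η) = η) (h₂ : ∀ x, ginv (g x) = x)
    (w : E × Module.Dual ℝ E) : MG E g ginv (MG E g ginv w) = w := by
  simp [h₁, h₂]

theorem naturalPairing_MG (hg : ∀ x y, g x y = g y x) (h₁ : ∀ η, g (ginv η) = η)
    (u v : E × Module.Dual ℝ E) :
    naturalPairing E (MG E g ginv u) (MG E g ginv v) = naturalPairing E u v := by
  simp only [naturalPairing_apply, MG_apply]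
  rw [hg v.1, hg u.1, h₁, h₁, add_comm]

theorem naturalPairing_MG_self_pos (hg : ∀ x, x ≠ 0 → 0 < g x x) (h₁ : ∀ η, g (ginv η) = η)
    {w : E × Module.Dual ℝ E} (hw : w ≠ 0) : 0 < naturalPairing E (MG E g ginv w) w := by
  have nonneg (x : E) : 0 ≤ g x x := by
    rcases eq_or_ne x 0 with rfl | hx
    · simp
    · exact (hg x hx).le
  have key : w.2 (ginv w.2) = g (ginv w.2) (ginv w.2) := by rw [h₁]
  simp only [naturalPairing_apply, MG_apply, key]
  by_cases hx : w.1 = 0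
  · have hη : ginv w.2 ≠ 0 := fun h => hw (Prod.ext hx (by rw [← h₁ w.2, h]; simp))
    linarith [hg _ hη, nonneg w.1]
  · linarith [hg _ hx, nonneg (ginv w.2)]

end MG

end

/-- for a positive definite symmetric bilinear form `g` (viewed as the
isomorphism `g : V → V*` with inverse `g⁻¹`) and an alternating bilinear form `B`,
the generalized metric `G := e^B ∘ M_G ∘ e^{-B}` satisfies `G² = id`, preserves the
natural pairing, and is positive definite: `⟨G w, w⟩ > 0` for every nonzero `w`. -/
theorem generalizedMetric_involution_isometry_posdef
    (g : LinearMap.BilinForm ℝ V)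
    (hgsymm : ∀ x y : V, g x y = g y x)
    (hgpos : ∀ x : V, x ≠ 0 → 0 < g x x)
    (ginv : Module.Dual ℝ V →ₗ[ℝ] V)
    (hginv₁ : (g : V →ₗ[ℝ] Module.Dual ℝ V) ∘ₗ ginv = LinearMap.id)
    (hginv₂ : ginv ∘ₗ (g : V →ₗ[ℝ] Module.Dual ℝ V) = LinearMap.id)
    (B : LinearMap.BilinForm ℝ V) (hB : B.IsAlt) :
    (bTransform V B ∘ₗ MG V g ginv ∘ₗ bTransform V (-B)) ∘ₗ
        (bTransform V B ∘ₗ MG V g ginv ∘ₗ bTransform V (-B)) = LinearMap.id ∧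
    (∀ u v : V × Module.Dual ℝ V,
      naturalPairing V ((bTransform V B ∘ₗ MG V g ginv ∘ₗ bTransform V (-B)) u)
          ((bTransform V B ∘ₗ MG V g ginv ∘ₗ bTransform V (-B)) v) =
        naturalPairing V u v) ∧
    (∀ w : V × Module.Dual ℝ V, w ≠ 0 →
      0 < naturalPairing V ((bTransform V B ∘ₗ MG V g ginv ∘ₗ bTransform V (-B)) w) w) := by
  have h₁ (η : Module.Dual ℝ V) : g (ginv η) = η := LinearMap.congr_fun hginv₁ η
  have h₂ (x : V) : ginv (g x) = x := LinearMap.congr_fun hginv₂ x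
  have hB' : (-B).IsAlt := hB.neg
  refine ⟨LinearMap.ext fun w => ?_, fun u v => ?_, fun w hw => ?_⟩
  · simp only [LinearMap.comp_apply, LinearMap.id_apply]
    rw [bTransform_neg_bTransform, MG_MG h₁ h₂, bTransform_bTransform_neg]
  · simp only [LinearMap.comp_apply]
    rw [naturalPairing_bTransform hB, naturalPairing_MG hgsymm h₁, naturalPairing_bTransform hB']
  · simp only [LinearMap.comp_apply]
    rw [naturalPairing_bTransform_left hB]
    refine naturalPairing_MG_self_pos hgpos h₁ fun h => hw ?_
    rw [← bTransform_bTransform_neg B w, h, map_zero]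
end

section
/- The map σ is an antisymmetric bivector: for all η, λ ∈ V*, λ(σ η) = −η(σ λ); equivalently, (J₊∘J₋ − J₋∘J₊) ∘ g⁻¹ = −g⁻¹ ∘ (J₊∘J₋ − J₋∘J₊)ᵗ. -/
open Module LinearMap

variable (V : Type*) [AddCommGroup V] [Module ℝ V] [FiniteDimensional ℝ V]

/-- An isometry of a bilinear form that squares to `-1` is skew-adjoint. -/
theorem bilinForm_apply_left_eq_neg_of_isometry {R W : Type*} [CommRing R] [AddCommGroup W]
    [Module R W] {B : LinearMap.BilinForm R W} {J : W →ₗ[R] W} (hJ : J ∘ₗ J = -LinearMap.id)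
    (hB : ∀ x y : W, B (J x) (J y) = B x y) (x y : W) : B (J x) y = -B x (J y) := by
  have hJJ : J (J x) = -x := by simpa using LinearMap.congr_fun hJ x
  rw [← hB (J x) y, hJJ, map_neg, LinearMap.neg_apply]

/-- the map `σ := [J₊,J₋] ∘ g⁻¹` is an antisymmetric bivector:
`λ(σ η) = -η(σ λ)` for all `η, λ ∈ V*`; equivalently
`[J₊,J₋] ∘ g⁻¹ = -g⁻¹ ∘ [J₊,J₋]ᵗ`. -/
theorem sigma_antisymmetric
    (g : LinearMap.BilinForm ℝ V)
    (hgsymm : ∀ x y : V, g x y = g y x)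
    (ginv : Module.Dual ℝ V →ₗ[ℝ] V)
    (hginv₁ : (g : V →ₗ[ℝ] Module.Dual ℝ V) ∘ₗ ginv = LinearMap.id)
    (hginv₂ : ginv ∘ₗ (g : V →ₗ[ℝ] Module.Dual ℝ V) = LinearMap.id)
    (Jp Jm : V →ₗ[ℝ] V)
    (hJp : Jp ∘ₗ Jp = -LinearMap.id) (hJm : Jm ∘ₗ Jm = -LinearMap.id)
    (hgp : ∀ x y : V, g (Jp x) (Jp y) = g x y)
    (hgm : ∀ x y : V, g (Jm x) (Jm y) = g x y) :
    (∀ η lam : Module.Dual ℝ V,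
      lam (((Jp ∘ₗ Jm - Jm ∘ₗ Jp) ∘ₗ ginv) η) =
        -η (((Jp ∘ₗ Jm - Jm ∘ₗ Jp) ∘ₗ ginv) lam)) ∧
    (Jp ∘ₗ Jm - Jm ∘ₗ Jp) ∘ₗ ginv = -(ginv ∘ₗ (Jp ∘ₗ Jm - Jm ∘ₗ Jp).dualMap) := by
  have hg (η : Module.Dual ℝ V) (x : V) : g (ginv η) x = η x :=
    LinearMap.congr_fun (LinearMap.congr_fun hginv₁ η) x
  have hskew (x y : V) :
      g ((Jp ∘ₗ Jm - Jm ∘ₗ Jp) x) y = -g x ((Jp ∘ₗ Jm - Jm ∘ₗ Jp) y) := by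
    simp only [LinearMap.sub_apply, LinearMap.comp_apply, map_sub,
      bilinForm_apply_left_eq_neg_of_isometry hJp hgp,
      bilinForm_apply_left_eq_neg_of_isometry hJm hgm]
    ring
  have hinj : Function.Injective g := Function.LeftInverse.injective (LinearMap.congr_fun hginv₂)
  refine ⟨fun η lam => ?_, LinearMap.ext fun η => hinj (LinearMap.ext fun x => ?_)⟩
  · rw [← hg lam, ← hg η, LinearMap.comp_apply, LinearMap.comp_apply, hgsymm, hskew]
  · rw [LinearMap.comp_apply, hskew, hg, LinearMap.neg_apply, map_neg, LinearMap.neg_apply,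
      LinearMap.comp_apply, hg, LinearMap.dualMap_apply]
end

section
/- The bivector σ has no (1,1) part with respect to either complex structure: J₊ ∘ σ ∘ J₊ᵗ = −σ and J₋ ∘ σ ∘ J₋ᵗ = −σ as maps V* → V. -/
open Module LinearMap

variable (V : Type*) [AddCommGroup V] [Module ℝ V] [FiniteDimensional ℝ V]

/-- A complex structure preserved by `g` is skew-adjoint, so `g⁻¹ ∘ Jᵗ = -J ∘ g⁻¹`. -/
theorem ginv_dualMap_eq_neg {R W : Type*} [CommRing R] [AddCommGroup W] [Module R W]
    {g : LinearMap.BilinForm R W} {ginv : Module.Dual R W →ₗ[R] W}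
    (hginv₁ : g ∘ₗ ginv = LinearMap.id) (hginv₂ : ginv ∘ₗ g = LinearMap.id)
    {J : W →ₗ[R] W} (hJ : J ∘ₗ J = -LinearMap.id)
    (hg : ∀ x y : W, g (J x) (J y) = g x y) (ξ : Module.Dual R W) :
    ginv (J.dualMap ξ) = -J (ginv ξ) := by
  have hξ : g (ginv ξ) = ξ := LinearMap.congr_fun hginv₁ ξ
  have key : J.dualMap ξ = g (-J (ginv ξ)) := by
    ext y
    have hJy : J (J y) = -y := LinearMap.congr_fun hJ y
    have h := hg (ginv ξ) (J y)
    rw [hJy, hξ, map_neg] at h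
    simpa using h.symm
  rw [key]
  exact LinearMap.congr_fun hginv₂ _

/-- the bivector `σ := [J₊,J₋] ∘ g⁻¹` has no (1,1) part with respect
to either complex structure: `J₊ ∘ σ ∘ J₊ᵗ = -σ` and `J₋ ∘ σ ∘ J₋ᵗ = -σ`. -/
theorem sigma_no_one_one_part
    (g : LinearMap.BilinForm ℝ V)
    (hgsymm : ∀ x y : V, g x y = g y x)
    (ginv : Module.Dual ℝ V →ₗ[ℝ] V)
    (hginv₁ : (g : V →ₗ[ℝ] Module.Dual ℝ V) ∘ₗ ginv = LinearMap.id)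
    (hginv₂ : ginv ∘ₗ (g : V →ₗ[ℝ] Module.Dual ℝ V) = LinearMap.id)
    (Jp Jm : V →ₗ[ℝ] V)
    (hJp : Jp ∘ₗ Jp = -LinearMap.id) (hJm : Jm ∘ₗ Jm = -LinearMap.id)
    (hgp : ∀ x y : V, g (Jp x) (Jp y) = g x y)
    (hgm : ∀ x y : V, g (Jm x) (Jm y) = g x y) :
    Jp ∘ₗ ((Jp ∘ₗ Jm - Jm ∘ₗ Jp) ∘ₗ ginv) ∘ₗ Jp.dualMap =
      -((Jp ∘ₗ Jm - Jm ∘ₗ Jp) ∘ₗ ginv) ∧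
    Jm ∘ₗ ((Jp ∘ₗ Jm - Jm ∘ₗ Jp) ∘ₗ ginv) ∘ₗ Jm.dualMap =
      -((Jp ∘ₗ Jm - Jm ∘ₗ Jp) ∘ₗ ginv) := by
  have hp (x : V) : Jp (Jp x) = -x := LinearMap.congr_fun hJp x
  have hm (x : V) : Jm (Jm x) = -x := LinearMap.congr_fun hJm x
  constructor
  · ext ξ
    simp [ginv_dualMap_eq_neg hginv₁ hginv₂ hJp hgp, hp]
  · ext ξ
    simp [ginv_dualMap_eq_neg hginv₁ hginv₂ hJm hgm, hm]
    abel
end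

section
/- The kernel of σ decomposes as the internal direct sum of the kernels of the two real Poisson structures: ker σ = ker π₊ + ker π₋ and ker π₊ ∩ ker π₋ = {0}. -/
open Module LinearMap

variable (V : Type*) [AddCommGroup V] [Module ℝ V] [FiniteDimensional ℝ V]

/-- the kernel of `σ := [J₊,J₋] ∘ g⁻¹` decomposes as the internal
direct sum of the kernels of the two real Poisson structures `π± := (J₊ ± J₋) ∘ g⁻¹`:
`ker σ = ker π₊ + ker π₋` and `ker π₊ ∩ ker π₋ = {0}`. -/
theorem ker_sigma_direct_sum
    (g : LinearMap.BilinForm ℝ V)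
    (hgsymm : ∀ x y : V, g x y = g y x)
    (ginv : Module.Dual ℝ V →ₗ[ℝ] V)
    (hginv₁ : (g : V →ₗ[ℝ] Module.Dual ℝ V) ∘ₗ ginv = LinearMap.id)
    (hginv₂ : ginv ∘ₗ (g : V →ₗ[ℝ] Module.Dual ℝ V) = LinearMap.id)
    (Jp Jm : V →ₗ[ℝ] V)
    (hJp : Jp ∘ₗ Jp = -LinearMap.id) (hJm : Jm ∘ₗ Jm = -LinearMap.id)
    (hgp : ∀ x y : V, g (Jp x) (Jp y) = g x y)
    (hgm : ∀ x y : V, g (Jm x) (Jm y) = g x y) :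
    LinearMap.ker ((Jp ∘ₗ Jm - Jm ∘ₗ Jp) ∘ₗ ginv) =
      LinearMap.ker ((Jp + Jm) ∘ₗ ginv) ⊔ LinearMap.ker ((Jp - Jm) ∘ₗ ginv) ∧
    LinearMap.ker ((Jp + Jm) ∘ₗ ginv) ⊓ LinearMap.ker ((Jp - Jm) ∘ₗ ginv) = ⊥ := by
  have hpp (x : V) : Jp (Jp x) = -x := by simpa using LinearMap.congr_fun hJp x
  have hmm (x : V) : Jm (Jm x) = -x := by simpa using LinearMap.congr_fun hJm x
  have hg₁ (ξ : Module.Dual ℝ V) : g (ginv ξ) = ξ := LinearMap.congr_fun hginv₁ ξ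
  have hg₂ (x : V) : ginv (g x) = x := LinearMap.congr_fun hginv₂ x
  refine ⟨le_antisymm (fun ξ hξ => ?_) (sup_le (fun ξ hξ => ?_) fun ξ hξ => ?_), ?_⟩
  · have hcomm : Jp (Jm (ginv ξ)) = Jm (Jp (ginv ξ)) := by
      simpa [sub_eq_zero] using hξ
    -- Split `v = g⁻¹ ξ` into its components in the `±1`-eigenspaces of `J₊ J₋`.
    refine Submodule.mem_sup.2
      ⟨g ((1 / 2 : ℝ) • (ginv ξ + Jp (Jm (ginv ξ)))), ?_,
        g ((1 / 2 : ℝ) • (ginv ξ - Jp (Jm (ginv ξ)))), ?_, ?_⟩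
    · rw [LinearMap.mem_ker, LinearMap.comp_apply, hg₂, map_smul]
      have : (Jp + Jm) (ginv ξ + Jp (Jm (ginv ξ))) = 0 := by
        rw [LinearMap.add_apply, map_add, map_add, hpp, hcomm, hmm]
        abel
      rw [this, smul_zero]
    · rw [LinearMap.mem_ker, LinearMap.comp_apply, hg₂, map_smul]
      have : (Jp - Jm) (ginv ξ - Jp (Jm (ginv ξ))) = 0 := by
        rw [LinearMap.sub_apply, map_sub, map_sub, hpp, hcomm, hmm]
        abel
      rw [this, smul_zero]
    · rw [← map_add, ← smul_add, add_add_sub_cancel, ← two_smul ℝ, smul_smul]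
      norm_num [hg₁]
  · have h : Jp (ginv ξ) = -Jm (ginv ξ) := by
      simpa [add_eq_zero_iff_eq_neg] using hξ
    have h' : Jm (ginv ξ) = -Jp (ginv ξ) := by rw [h, neg_neg]
    simp only [LinearMap.mem_ker, LinearMap.comp_apply, LinearMap.sub_apply]
    rw [h', map_neg, hpp, h, map_neg, hmm, sub_self]
  · have h : Jp (ginv ξ) = Jm (ginv ξ) := by
      simpa [sub_eq_zero] using hξ
    simp only [LinearMap.mem_ker, LinearMap.comp_apply, LinearMap.sub_apply]
    rw [← h, hpp, h, hmm, sub_self]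
  · refine (Submodule.eq_bot_iff _).2 fun ξ ⟨hp, hm⟩ => ?_
    have hp' : Jp (ginv ξ) + Jm (ginv ξ) = 0 := hp
    have hm' : Jp (ginv ξ) - Jm (ginv ξ) = 0 := hm
    have h0 : Jp (ginv ξ) = 0 := by
      rw [← sub_eq_zero.1 hm', ← two_smul ℝ] at hp'
      simpa using hp'
    have hv : ginv ξ = 0 := by simpa [h0] using (hpp (ginv ξ)).symm
    rw [← hg₁ ξ, hv, map_zero]
end

section
/- Assume σ is invertible and let Ω := σ⁻¹ : V → V*. Then Ω ∘ (J₊∘J₋ − J₋∘J₊) = g as maps V → V*, and the map B := Ω ∘ (J₊∘J₋ + J₋∘J₊) : V → V* is antisymmetric: (B x)(y) = −(B y)(x) for all x, y ∈ V. -/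
open Module LinearMap

variable (V : Type*) [AddCommGroup V] [Module ℝ V] [FiniteDimensional ℝ V]

/-- A complex structure preserving a bilinear form is skew-adjoint for it. -/
lemma apply_complexStructure_left {W : Type*} [AddCommGroup W] [Module ℝ W]
    {g : LinearMap.BilinForm ℝ W} {J : W →ₗ[ℝ] W} (hJ : ∀ x, J (J x) = -x)
    (hg : ∀ x y, g (J x) (J y) = g x y) (x y : W) : g (J x) y = -g x (J y) := by
  have h := hg x (J y)
  rw [hJ, map_neg] at h
  linarith

/-- assume `σ := [J₊,J₋] ∘ g⁻¹` is invertible with inverse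
`Ω := σ⁻¹ : V → V*`. Then `Ω ∘ [J₊,J₋] = g` and the map
`B := Ω ∘ {J₊,J₋} : V → V*` is antisymmetric: `(B x)(y) = -(B y)(x)`. -/
theorem omega_comm_eq_g_and_B_antisymmetric
    (g : LinearMap.BilinForm ℝ V)
    (hgsymm : ∀ x y : V, g x y = g y x)
    (ginv : Module.Dual ℝ V →ₗ[ℝ] V)
    (hginv₁ : (g : V →ₗ[ℝ] Module.Dual ℝ V) ∘ₗ ginv = LinearMap.id)
    (hginv₂ : ginv ∘ₗ (g : V →ₗ[ℝ] Module.Dual ℝ V) = LinearMap.id)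
    (Jp Jm : V →ₗ[ℝ] V)
    (hJp : Jp ∘ₗ Jp = -LinearMap.id) (hJm : Jm ∘ₗ Jm = -LinearMap.id)
    (hgp : ∀ x y : V, g (Jp x) (Jp y) = g x y)
    (hgm : ∀ x y : V, g (Jm x) (Jm y) = g x y)
    (Ω : V →ₗ[ℝ] Module.Dual ℝ V)
    (hΩ₁ : Ω ∘ₗ ((Jp ∘ₗ Jm - Jm ∘ₗ Jp) ∘ₗ ginv) = LinearMap.id)
    (hΩ₂ : ((Jp ∘ₗ Jm - Jm ∘ₗ Jp) ∘ₗ ginv) ∘ₗ Ω = LinearMap.id) :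
    Ω ∘ₗ (Jp ∘ₗ Jm - Jm ∘ₗ Jp) = (g : V →ₗ[ℝ] Module.Dual ℝ V) ∧
    ∀ x y : V, (Ω ∘ₗ (Jp ∘ₗ Jm + Jm ∘ₗ Jp)) x y =
      -((Ω ∘ₗ (Jp ∘ₗ Jm + Jm ∘ₗ Jp)) y x) := by
  have hp : ∀ x, Jp (Jp x) = -x := fun x => LinearMap.congr_fun hJp x
  have hm : ∀ x, Jm (Jm x) = -x := fun x => LinearMap.congr_fun hJm x
  have hΩg : Ω ∘ₗ (Jp ∘ₗ Jm - Jm ∘ₗ Jp) = (g : V →ₗ[ℝ] Module.Dual ℝ V) := by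
    calc Ω ∘ₗ (Jp ∘ₗ Jm - Jm ∘ₗ Jp)
        = (Ω ∘ₗ ((Jp ∘ₗ Jm - Jm ∘ₗ Jp) ∘ₗ ginv)) ∘ₗ g := by
          rw [LinearMap.comp_assoc, LinearMap.comp_assoc, hginv₂, LinearMap.comp_id]
      _ = g := by rw [hΩ₁, LinearMap.id_comp]
  refine ⟨hΩg, fun x y => ?_⟩
  have hsurj : ∀ z, ∃ u, Jp (Jm u) - Jm (Jp u) = z :=
    fun z => ⟨ginv (Ω z), LinearMap.congr_fun hΩ₂ z⟩
  have hΩ : ∀ u, Ω (Jp (Jm u) - Jm (Jp u)) = g u := LinearMap.congr_fun hΩg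
  have hcomm : ∀ u, Jp (Jm (Jp (Jm u) - Jm (Jp u))) + Jm (Jp (Jp (Jm u) - Jm (Jp u))) =
      Jp (Jm (Jp (Jm u) + Jm (Jp u))) - Jm (Jp (Jp (Jm u) + Jm (Jp u))) := by
    intro u
    simp only [map_sub, map_add, map_neg, hp, hm]
    abel
  obtain ⟨u, rfl⟩ := hsurj x
  obtain ⟨v, rfl⟩ := hsurj y
  simp only [LinearMap.comp_apply, LinearMap.add_apply]
  rw [hcomm, hcomm, hΩ, hΩ]
  have hgJp := apply_complexStructure_left hp hgp
  have hgJm := apply_complexStructure_left hm hgm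
  simp only [map_add, map_sub, map_neg, LinearMap.add_apply, hgJp, hgJm, hp, hm]
  rw [hgsymm v u, hgsymm v (Jp _), hgsymm v (Jm _)]
  simp only [hgJp, hgJm]
  ring
end

section
/- The Gualtieri maps 𝒥₁ and 𝒥₂ are generalized almost complex structures on W: 𝒥₁² = −id, 𝒥₂² = −id, and both preserve the natural pairing, ⟨𝒥ᵢ u, 𝒥ᵢ v⟩ = ⟨u, v⟩ for all u, v ∈ W and i = 1, 2. -/
open Module LinearMap

variable (V : Type*) [AddCommGroup V] [Module ℝ V] [FiniteDimensional ℝ V]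

/-- The first Gualtieri map `𝒥₁ := e^B ∘ (1/2)·M₁ ∘ e^{-B}`, where
`M₁(X,η) := ((J₊ + J₋)X - (ω₊⁻¹ - ω₋⁻¹)η, (ω₊ - ω₋)X - (J₊ᵗ + J₋ᵗ)η)`,
with `ω± := g ∘ J±` and `ω±⁻¹` given by `ωpinv`, `ωminv`. -/
noncomputable def gualtieriJ1 (g : LinearMap.BilinForm ℝ V) (Jp Jm : V →ₗ[ℝ] V)
    (ωpinv ωminv : Module.Dual ℝ V →ₗ[ℝ] V) (B : LinearMap.BilinForm ℝ V) :
    (V × Module.Dual ℝ V) →ₗ[ℝ] V × Module.Dual ℝ V :=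
  bTransform V B ∘ₗ
    ((1 / 2 : ℝ) •
      (((Jp + Jm) ∘ₗ LinearMap.fst ℝ V (Module.Dual ℝ V)
          - (ωpinv - ωminv) ∘ₗ LinearMap.snd ℝ V (Module.Dual ℝ V)).prod
        (((g : V →ₗ[ℝ] Module.Dual ℝ V) ∘ₗ Jp - (g : V →ₗ[ℝ] Module.Dual ℝ V) ∘ₗ Jm)
            ∘ₗ LinearMap.fst ℝ V (Module.Dual ℝ V)
          - (Jp.dualMap + Jm.dualMap) ∘ₗ LinearMap.snd ℝ V (Module.Dual ℝ V)))) ∘ₗ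
    bTransform V (-B)

/-- The second Gualtieri map `𝒥₂ := e^B ∘ (1/2)·M₂ ∘ e^{-B}`, where
`M₂(X,η) := ((J₊ - J₋)X - (ω₊⁻¹ + ω₋⁻¹)η, (ω₊ + ω₋)X - (J₊ᵗ - J₋ᵗ)η)`,
with `ω± := g ∘ J±` and `ω±⁻¹` given by `ωpinv`, `ωminv`. -/
noncomputable def gualtieriJ2 (g : LinearMap.BilinForm ℝ V) (Jp Jm : V →ₗ[ℝ] V)
    (ωpinv ωminv : Module.Dual ℝ V →ₗ[ℝ] V) (B : LinearMap.BilinForm ℝ V) :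
    (V × Module.Dual ℝ V) →ₗ[ℝ] V × Module.Dual ℝ V :=
  bTransform V B ∘ₗ
    ((1 / 2 : ℝ) •
      (((Jp - Jm) ∘ₗ LinearMap.fst ℝ V (Module.Dual ℝ V)
          - (ωpinv + ωminv) ∘ₗ LinearMap.snd ℝ V (Module.Dual ℝ V)).prod
        (((g : V →ₗ[ℝ] Module.Dual ℝ V) ∘ₗ Jp + (g : V →ₗ[ℝ] Module.Dual ℝ V) ∘ₗ Jm)
            ∘ₗ LinearMap.fst ℝ V (Module.Dual ℝ V)
          - (Jp.dualMap - Jm.dualMap) ∘ₗ LinearMap.snd ℝ V (Module.Dual ℝ V)))) ∘ₗ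
    bTransform V (-B)

set_option linter.unusedSectionVars false

/-- The element `(a + b, B (a + b) + g (a - b))` of `W`: the sum of the lifts of `a` and `b` to the
graphs of `B + g` and `B - g`. -/
noncomputable def sumOfGraphLifts (g B : LinearMap.BilinForm ℝ V) (a b : V) :
    V × Module.Dual ℝ V :=
  (a + b, B (a + b) + g (a - b))

theorem exists_eq_sumOfGraphLifts {g : LinearMap.BilinForm ℝ V}
    (hg : Function.Surjective (g : V →ₗ[ℝ] Module.Dual ℝ V)) (B : LinearMap.BilinForm ℝ V)
    (u : V × Module.Dual ℝ V) : ∃ a b, u = sumOfGraphLifts V g B a b := by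
  obtain ⟨x, η⟩ := u
  obtain ⟨z, hz⟩ := hg (η - B x)
  refine ⟨(1 / 2 : ℝ) • (x + z), (1 / 2 : ℝ) • (x - z), ?_⟩
  have hx : (1 / 2 : ℝ) • (x + z) + (1 / 2 : ℝ) • (x - z) = x := by module
  have hz' : (1 / 2 : ℝ) • (x + z) - (1 / 2 : ℝ) • (x - z) = z := by module
  simp only [sumOfGraphLifts, hx, hz', hz, add_sub_cancel]

theorem naturalPairing_sumOfGraphLifts {g B : LinearMap.BilinForm ℝ V}
    (hgsymm : ∀ x y : V, g x y = g y x) (hB : B.IsAlt) (a b c d : V) :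
    naturalPairing V (sumOfGraphLifts V g B a b) (sumOfGraphLifts V g B c d)
      = g a c - g b d := by
  have hBneg := hB.neg_eq (a + b) (c + d)
  simp only [naturalPairing, sumOfGraphLifts, LinearMap.mk₂_apply, LinearMap.add_apply,
    LinearMap.sub_apply, map_add, map_sub] at hBneg ⊢
  linarith [hgsymm a c, hgsymm a d, hgsymm b c, hgsymm b d]

theorem dualMap_apply_of_isometry {g : LinearMap.BilinForm ℝ V} {J : V →ₗ[ℝ] V}
    (hJ : J ∘ₗ J = -LinearMap.id) (hg : ∀ x y : V, g (J x) (J y) = g x y) (x : V) :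
    J.dualMap (g x) = -g (J x) := by
  ext y
  have hJx : J (J x) = -x := LinearMap.congr_fun hJ x
  have h := hg (J x) y
  rw [hJx, map_neg, LinearMap.neg_apply] at h
  rw [LinearMap.dualMap_apply, LinearMap.neg_apply, ← h, neg_neg]

theorem leftInverse_apply {g : LinearMap.BilinForm ℝ V} {J : V →ₗ[ℝ] V}
    (hJ : J ∘ₗ J = -LinearMap.id) {ωinv : Module.Dual ℝ V →ₗ[ℝ] V}
    (hω : ωinv ∘ₗ ((g : V →ₗ[ℝ] Module.Dual ℝ V) ∘ₗ J) = LinearMap.id) (x : V) :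
    ωinv (g x) = -J x := by
  have hJx : J (J x) = -x := LinearMap.congr_fun hJ x
  have h : ωinv (g (J (J x))) = J x := LinearMap.congr_fun hω (J x)
  rw [hJx, map_neg, map_neg] at h
  rw [← h, neg_neg]

/-- `𝒥₁` acts as `J₊` on the graph of `B + g` and as `J₋` on the graph of `B - g`. -/
theorem gualtieriJ1_sumOfGraphLifts {g : LinearMap.BilinForm ℝ V} {Jp Jm : V →ₗ[ℝ] V}
    (hJp : Jp ∘ₗ Jp = -LinearMap.id) (hJm : Jm ∘ₗ Jm = -LinearMap.id)
    (hgp : ∀ x y : V, g (Jp x) (Jp y) = g x y)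
    (hgm : ∀ x y : V, g (Jm x) (Jm y) = g x y)
    {ωpinv ωminv : Module.Dual ℝ V →ₗ[ℝ] V}
    (hωp : ωpinv ∘ₗ ((g : V →ₗ[ℝ] Module.Dual ℝ V) ∘ₗ Jp) = LinearMap.id)
    (hωm : ωminv ∘ₗ ((g : V →ₗ[ℝ] Module.Dual ℝ V) ∘ₗ Jm) = LinearMap.id)
    (B : LinearMap.BilinForm ℝ V) (a b : V) :
    gualtieriJ1 V g Jp Jm ωpinv ωminv B (sumOfGraphLifts V g B a b)
      = sumOfGraphLifts V g B (Jp a) (Jm b) := by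
  have hB : bTransform V (-B) (sumOfGraphLifts V g B a b) = (a + b, g (a - b)) := by
    refine Prod.ext rfl ?_
    change B (a + b) + g (a - b) + -B (a + b) = g (a - b)
    abel
  have hM : (1 / 2 : ℝ) • ((Jp + Jm) (a + b) - (ωpinv - ωminv) (g (a - b)),
        (g ∘ₗ Jp - g ∘ₗ Jm) (a + b) - (Jp.dualMap + Jm.dualMap) (g (a - b)))
      = (Jp a + Jm b, g (Jp a - Jm b)) := by
    simp only [LinearMap.add_apply, LinearMap.sub_apply, LinearMap.comp_apply,
      dualMap_apply_of_isometry V hJp hgp, dualMap_apply_of_isometry V hJm hgm,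
      leftInverse_apply V hJp hωp, leftInverse_apply V hJm hωm, map_add, map_sub,
      Prod.smul_mk, Prod.mk.injEq]
    constructor <;> module
  rw [gualtieriJ1, LinearMap.comp_apply, LinearMap.comp_apply, hB]
  refine (congrArg (bTransform V B) hM).trans ?_
  simp [bTransform, sumOfGraphLifts, add_comm]

theorem gualtieriJ1_isGeneralizedAlmostComplex {g : LinearMap.BilinForm ℝ V}
    (hgsymm : ∀ x y : V, g x y = g y x) {Jp Jm : V →ₗ[ℝ] V}
    (hJp : Jp ∘ₗ Jp = -LinearMap.id) (hJm : Jm ∘ₗ Jm = -LinearMap.id)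
    (hgp : ∀ x y : V, g (Jp x) (Jp y) = g x y)
    (hgm : ∀ x y : V, g (Jm x) (Jm y) = g x y)
    {ωpinv ωminv : Module.Dual ℝ V →ₗ[ℝ] V}
    (hωp₁ : ((g : V →ₗ[ℝ] Module.Dual ℝ V) ∘ₗ Jp) ∘ₗ ωpinv = LinearMap.id)
    (hωp₂ : ωpinv ∘ₗ ((g : V →ₗ[ℝ] Module.Dual ℝ V) ∘ₗ Jp) = LinearMap.id)
    (hωm₂ : ωminv ∘ₗ ((g : V →ₗ[ℝ] Module.Dual ℝ V) ∘ₗ Jm) = LinearMap.id)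
    {B : LinearMap.BilinForm ℝ V} (hB : B.IsAlt) :
    gualtieriJ1 V g Jp Jm ωpinv ωminv B ∘ₗ gualtieriJ1 V g Jp Jm ωpinv ωminv B
      = -LinearMap.id ∧
    ∀ u v : V × Module.Dual ℝ V,
      naturalPairing V (gualtieriJ1 V g Jp Jm ωpinv ωminv B u)
        (gualtieriJ1 V g Jp Jm ωpinv ωminv B v) = naturalPairing V u v := by
  have hg : Function.Surjective (g : V →ₗ[ℝ] Module.Dual ℝ V) :=
    fun η => ⟨Jp (ωpinv η), LinearMap.congr_fun hωp₁ η⟩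
  have hJ := gualtieriJ1_sumOfGraphLifts V hJp hJm hgp hgm hωp₂ hωm₂ B
  constructor
  · refine LinearMap.ext fun u => ?_
    obtain ⟨a, b, rfl⟩ := exists_eq_sumOfGraphLifts V hg B u
    have ha : Jp (Jp a) = -a := LinearMap.congr_fun hJp a
    have hb : Jm (Jm b) = -b := LinearMap.congr_fun hJm b
    rw [LinearMap.comp_apply, hJ, hJ, ha, hb, LinearMap.neg_apply, LinearMap.id_apply]
    simp only [sumOfGraphLifts, map_add, map_sub, map_neg, Prod.neg_mk, Prod.mk.injEq]
    constructor <;> abel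
  · intro u v
    obtain ⟨a, b, rfl⟩ := exists_eq_sumOfGraphLifts V hg B u
    obtain ⟨c, d, rfl⟩ := exists_eq_sumOfGraphLifts V hg B v
    rw [hJ, hJ, naturalPairing_sumOfGraphLifts V hgsymm hB,
      naturalPairing_sumOfGraphLifts V hgsymm hB, hgp, hgm]

theorem gualtieriJ2_eq_gualtieriJ1_neg (g : LinearMap.BilinForm ℝ V) (Jp Jm : V →ₗ[ℝ] V)
    (ωpinv ωminv : Module.Dual ℝ V →ₗ[ℝ] V) (B : LinearMap.BilinForm ℝ V) :
    gualtieriJ2 V g Jp Jm ωpinv ωminv B = gualtieriJ1 V g Jp (-Jm) ωpinv (-ωminv) B := by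
  have hdual : Jp.dualMap + (-Jm).dualMap = Jp.dualMap - Jm.dualMap := by
    ext η x
    simp [sub_eq_add_neg]
  have hω : (g : V →ₗ[ℝ] Module.Dual ℝ V) ∘ₗ Jp - (g : V →ₗ[ℝ] Module.Dual ℝ V) ∘ₗ (-Jm)
      = (g : V →ₗ[ℝ] Module.Dual ℝ V) ∘ₗ Jp + (g : V →ₗ[ℝ] Module.Dual ℝ V) ∘ₗ Jm := by
    ext x y
    simp
  rw [gualtieriJ1, gualtieriJ2, hdual, hω, sub_neg_eq_add, ← sub_eq_add_neg]

/-- the Gualtieri maps `𝒥₁` and `𝒥₂` are generalized almost complex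
structures on `W`: `𝒥ᵢ² = -id` and both preserve the natural pairing. -/
theorem gualtieri_maps_are_gacs
    (g : LinearMap.BilinForm ℝ V)
    (hgsymm : ∀ x y : V, g x y = g y x)
    (Jp Jm : V →ₗ[ℝ] V)
    (hJp : Jp ∘ₗ Jp = -LinearMap.id) (hJm : Jm ∘ₗ Jm = -LinearMap.id)
    (hgp : ∀ x y : V, g (Jp x) (Jp y) = g x y)
    (hgm : ∀ x y : V, g (Jm x) (Jm y) = g x y)
    (ωpinv ωminv : Module.Dual ℝ V →ₗ[ℝ] V)
    (hωp₁ : ((g : V →ₗ[ℝ] Module.Dual ℝ V) ∘ₗ Jp) ∘ₗ ωpinv = LinearMap.id)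
    (hωp₂ : ωpinv ∘ₗ ((g : V →ₗ[ℝ] Module.Dual ℝ V) ∘ₗ Jp) = LinearMap.id)
    (hωm₁ : ((g : V →ₗ[ℝ] Module.Dual ℝ V) ∘ₗ Jm) ∘ₗ ωminv = LinearMap.id)
    (hωm₂ : ωminv ∘ₗ ((g : V →ₗ[ℝ] Module.Dual ℝ V) ∘ₗ Jm) = LinearMap.id)
    (B : LinearMap.BilinForm ℝ V) (hB : B.IsAlt) :
    gualtieriJ1 V g Jp Jm ωpinv ωminv B ∘ₗ gualtieriJ1 V g Jp Jm ωpinv ωminv B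
      = -LinearMap.id ∧
    gualtieriJ2 V g Jp Jm ωpinv ωminv B ∘ₗ gualtieriJ2 V g Jp Jm ωpinv ωminv B
      = -LinearMap.id ∧
    (∀ u v : V × Module.Dual ℝ V,
      naturalPairing V (gualtieriJ1 V g Jp Jm ωpinv ωminv B u)
        (gualtieriJ1 V g Jp Jm ωpinv ωminv B v) = naturalPairing V u v) ∧
    (∀ u v : V × Module.Dual ℝ V,
      naturalPairing V (gualtieriJ2 V g Jp Jm ωpinv ωminv B u)
        (gualtieriJ2 V g Jp Jm ωpinv ωminv B v) = naturalPairing V u v) := by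
  have h₁ := gualtieriJ1_isGeneralizedAlmostComplex V hgsymm hJp hJm hgp hgm hωp₁ hωp₂ hωm₂ hB
  have h₂ := gualtieriJ1_isGeneralizedAlmostComplex V hgsymm (Jm := -Jm) (ωminv := -ωminv)
    hJp (by simpa [LinearMap.comp_neg, LinearMap.neg_comp] using hJm) hgp (by simpa using hgm)
    hωp₁ hωp₂ (by simpa [LinearMap.comp_neg, LinearMap.neg_comp] using hωm₂) hB
  rw [← gualtieriJ2_eq_gualtieriJ1_neg] at h₂
  exact ⟨h₁.1, h₂.1, h₁.2, h₂.2⟩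
end

section
/- With Π± := (1/2)(id ± G), where G := e^B ∘ M_G ∘ e^{−B} and M_G(X,η) := (g⁻¹η, g X), and with 𝒥_{±B} := e^B ∘ 𝒥_{J±} ∘ e^{−B}, where 𝒥_{J±}(X,η) := (J± X, −J±ᵗ η), the Gualtieri maps satisfy 𝒥₁ = Π₊ ∘ 𝒥_{+B} + Π₋ ∘ 𝒥_{−B} and 𝒥₂ = Π₊ ∘ 𝒥_{+B} − Π₋ ∘ 𝒥_{−B}. -/
open Module LinearMap

variable (V : Type*) [AddCommGroup V] [Module ℝ V] [FiniteDimensional ℝ V]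

/-- If `J` preserves `g`, then the inverse of `ω = g ∘ J` is `g⁻¹ ∘ Jᵗ`. -/
theorem omega_inv_eq_comp_dualMap {E : Type*} [AddCommGroup E] [Module ℝ E]
    {g : LinearMap.BilinForm ℝ E} {ginv ωinv : Module.Dual ℝ E →ₗ[ℝ] E} {J : E →ₗ[ℝ] E}
    (hginv : ginv ∘ₗ (g : E →ₗ[ℝ] Module.Dual ℝ E) = LinearMap.id)
    (hgJ : ∀ x y : E, g (J x) (J y) = g x y)
    (hω : ((g : E →ₗ[ℝ] Module.Dual ℝ E) ∘ₗ J) ∘ₗ ωinv = LinearMap.id) :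
    ωinv = ginv ∘ₗ J.dualMap := by
  have hJ : J.dualMap ∘ₗ (g : E →ₗ[ℝ] Module.Dual ℝ E) ∘ₗ J = g := by
    ext x y
    exact hgJ x y
  calc ωinv = (ginv ∘ₗ (J.dualMap ∘ₗ (g : E →ₗ[ℝ] Module.Dual ℝ E) ∘ₗ J)) ∘ₗ ωinv := by
        rw [hJ, hginv, LinearMap.id_comp]
    _ = (ginv ∘ₗ J.dualMap) ∘ₗ (((g : E →ₗ[ℝ] Module.Dual ℝ E) ∘ₗ J) ∘ₗ ωinv) := rfl
    _ = ginv ∘ₗ J.dualMap := by rw [hω, LinearMap.comp_id]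

/-- with `Π± := (1/2)(id ± G)`, where `G := e^B ∘ M_G ∘ e^{-B}`, and
with `𝒥_{±B} := e^B ∘ 𝒥_{J±} ∘ e^{-B}`, where `𝒥_{J±}(X,η) := (J± X, -J±ᵗ η)`, the
Gualtieri maps satisfy `𝒥₁ = Π₊ ∘ 𝒥_{+B} + Π₋ ∘ 𝒥_{-B}` and
`𝒥₂ = Π₊ ∘ 𝒥_{+B} - Π₋ ∘ 𝒥_{-B}`. -/
theorem gualtieri_maps_projector_decomposition
    (g : LinearMap.BilinForm ℝ V)
    (hgsymm : ∀ x y : V, g x y = g y x)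
    (ginv : Module.Dual ℝ V →ₗ[ℝ] V)
    (hginv₁ : (g : V →ₗ[ℝ] Module.Dual ℝ V) ∘ₗ ginv = LinearMap.id)
    (hginv₂ : ginv ∘ₗ (g : V →ₗ[ℝ] Module.Dual ℝ V) = LinearMap.id)
    (Jp Jm : V →ₗ[ℝ] V)
    (hJp : Jp ∘ₗ Jp = -LinearMap.id) (hJm : Jm ∘ₗ Jm = -LinearMap.id)
    (hgp : ∀ x y : V, g (Jp x) (Jp y) = g x y)
    (hgm : ∀ x y : V, g (Jm x) (Jm y) = g x y)
    (ωpinv ωminv : Module.Dual ℝ V →ₗ[ℝ] V)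
    (hωp₁ : ((g : V →ₗ[ℝ] Module.Dual ℝ V) ∘ₗ Jp) ∘ₗ ωpinv = LinearMap.id)
    (hωp₂ : ωpinv ∘ₗ ((g : V →ₗ[ℝ] Module.Dual ℝ V) ∘ₗ Jp) = LinearMap.id)
    (hωm₁ : ((g : V →ₗ[ℝ] Module.Dual ℝ V) ∘ₗ Jm) ∘ₗ ωminv = LinearMap.id)
    (hωm₂ : ωminv ∘ₗ ((g : V →ₗ[ℝ] Module.Dual ℝ V) ∘ₗ Jm) = LinearMap.id)
    (B : LinearMap.BilinForm ℝ V) (hB : B.IsAlt) :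
    gualtieriJ1 V g Jp Jm ωpinv ωminv B =
      ((1 / 2 : ℝ) • (LinearMap.id + bTransform V B ∘ₗ MG V g ginv ∘ₗ bTransform V (-B)))
          ∘ₗ (bTransform V B ∘ₗ Jp.prodMap (-Jp.dualMap) ∘ₗ bTransform V (-B))
        + ((1 / 2 : ℝ) • (LinearMap.id - bTransform V B ∘ₗ MG V g ginv ∘ₗ bTransform V (-B)))
          ∘ₗ (bTransform V B ∘ₗ Jm.prodMap (-Jm.dualMap) ∘ₗ bTransform V (-B)) ∧
    gualtieriJ2 V g Jp Jm ωpinv ωminv B =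
      ((1 / 2 : ℝ) • (LinearMap.id + bTransform V B ∘ₗ MG V g ginv ∘ₗ bTransform V (-B)))
          ∘ₗ (bTransform V B ∘ₗ Jp.prodMap (-Jp.dualMap) ∘ₗ bTransform V (-B))
        - ((1 / 2 : ℝ) • (LinearMap.id - bTransform V B ∘ₗ MG V g ginv ∘ₗ bTransform V (-B)))
          ∘ₗ (bTransform V B ∘ₗ Jm.prodMap (-Jm.dualMap) ∘ₗ bTransform V (-B)) := by
  rw [omega_inv_eq_comp_dualMap hginv₂ hgp hωp₁, omega_inv_eq_comp_dualMap hginv₂ hgm hωm₁]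
  constructor <;> refine LinearMap.ext fun ⟨X, η⟩ => Prod.ext ?_ (LinearMap.ext fun y => ?_)
  all_goals
    simp [gualtieriJ1, gualtieriJ2, bTransform, MG]
    first | module | ring
end

section
/- The quotient metric g̃ defined by g̃(X,Y) := g(X,Y) − g(θ_R(Y), θ_L(X)) − g(θ_R(X), θ_L(Y)) is a symmetric bilinear form on W which vanishes in all vertical directions: g̃(v, Y) = 0 and g̃(Y, v) = 0 for every v ∈ L + R and every Y ∈ W. -/
open Module LinearMap

/-- the quotient metric
`g̃(X,Y) := g(X,Y) - g(θ_R(Y), θ_L(X)) - g(θ_R(X), θ_L(Y))` is a symmetric bilinear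
form on `W` which vanishes in all vertical directions, i.e. when either argument
lies in `L + R`. -/
theorem quotient_metric_symmetric_vanishes_vertically
    (W : Type*) [AddCommGroup W] [Module ℝ W] [FiniteDimensional ℝ W]
    (g : LinearMap.BilinForm ℝ W)
    (hgsymm : ∀ x y : W, g x y = g y x)
    (L R : Submodule ℝ W)
    (hL : ∀ l ∈ L, ∀ l' ∈ L, g l l' = 0)
    (hR : ∀ r ∈ R, ∀ r' ∈ R, g r r' = 0)
    (hnd₁ : ∀ r ∈ R, (∀ l ∈ L, g r l = 0) → r = 0)
    (hnd₂ : ∀ l ∈ L, (∀ r ∈ R, g r l = 0) → l = 0)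
    (θL θR : W →ₗ[ℝ] W)
    (hθL : ∀ X : W, θL X ∈ L ∧ ∀ r ∈ R, g r (θL X) = g r X)
    (hθR : ∀ X : W, θR X ∈ R ∧ ∀ l ∈ L, g l (θR X) = g l X) :
    -- the quotient metric as a bilinear form on `W`
    let tg : LinearMap.BilinForm ℝ W :=
      g - (g.compl₁₂ θR θL).flip - g.compl₁₂ θR θL
    (∀ X Y : W, tg X Y = g X Y - g (θR Y) (θL X) - g (θR X) (θL Y)) ∧
    (∀ X Y : W, tg X Y = tg Y X) ∧
    (∀ v ∈ L ⊔ R, ∀ Y : W, tg v Y = 0 ∧ tg Y v = 0) := by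
  intro tg
  have formula : ∀ X Y : W, tg X Y = g X Y - g (θR Y) (θL X) - g (θR X) (θL Y) :=
    fun _ _ => rfl
  have symm : ∀ X Y : W, tg X Y = tg Y X := fun X Y => by
    rw [formula, formula, hgsymm X Y]
    ring
  have vanish_left : ∀ l ∈ L, ∀ Y : W, tg l Y = 0 := fun l hl Y => by
    rw [formula, (hθL l).2 _ (hθR Y).1, hgsymm (θR Y) l, (hθR Y).2 l hl,
      hgsymm (θR l), (hθR l).2 _ (hθL Y).1, hL _ (hθL Y).1 l hl]
    ring
  have vanish_right : ∀ r ∈ R, ∀ Y : W, tg r Y = 0 := fun r hr Y => by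
    rw [formula, (hθL r).2 _ (hθR Y).1, hR _ (hθR Y).1 r hr,
      hgsymm (θR r), (hθR r).2 _ (hθL Y).1, hgsymm (θL Y) r, (hθL Y).2 r hr]
    ring
  have vanish : ∀ v ∈ L ⊔ R, ∀ Y : W, tg v Y = 0 := fun v hv Y => by
    obtain ⟨l, hl, r, hr, rfl⟩ := Submodule.mem_sup.mp hv
    rw [map_add, LinearMap.add_apply, vanish_left l hl, vanish_right r hr, add_zero]
  exact ⟨formula, symm, fun v hv Y => ⟨vanish v hv Y, symm Y v ▸ vanish v hv Y⟩⟩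
end
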